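/- (Turán's theorem) Let G be a simple graph on n vertices and let r ≥ 1 be a natural number. If G contains no clique on r+1 vertices (i.e., G is K_{r+1}-free), then the number of edges e(G) of G satisfies e(G) ≤ ((r−1)/r) · n²/2. -/

import Mathlib

/-- **Turán's theorem.** If a simple graph `G` on `n` vertices contains no clique on
`r + 1` vertices, then its number of edges is at most `((r - 1) / r) * n ^ 2 / 2`. -/
theorem turan_edge_bound {V : Type*} [Fintype V] [DecidableEq V]
    (G : SimpleGraph V) [DecidableRel G.Adj] (n r : ℕ) (hn : Fintype.card V = n)
    (hr : 1 ≤ r) (hfree : G.CliqueFree (r + 1)) :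
    (G.edgeFinset.card : ℝ) ≤ ((r : ℝ) - 1) / r * n ^ 2 / 2 := by
  have h1 := hfree.card_edgeFinset_le
  have h2 := SimpleGraph.mul_card_edgeFinset_turanGraph_le (n := n) (r := r)
  simp only [hn] at h1
  rw [← SimpleGraph.card_edgeFinset_turanGraph] at h1
  have h3 : 2 * r * G.edgeFinset.card ≤ (r - 1) * n ^ 2 :=
    le_trans (Nat.mul_le_mul_left _ h1) h2
  have h4 : ((2 * r * G.edgeFinset.card : ℕ) : ℝ) ≤ (((r - 1) * n ^ 2 : ℕ) : ℝ) :=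
    Nat.cast_le.mpr h3
  push_cast [Nat.cast_sub hr] at h4
  have hr0 : (0 : ℝ) < r := by exact_mod_cast hr
  have e : ((r : ℝ) - 1) / r * n ^ 2 / 2 = (((r : ℝ) - 1) * n ^ 2) / (2 * r) := by
    field_simp
  rw [e, le_div_iff₀ (by positivity)]
  linarith
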